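/- The ideal generated by the four quadrics q0, q1, q2, q3 in the polynomial ring ℂ[a^(k)_(i,j)] in 12 variables is a prime ideal; equivalently, the complete intersection Q = V(q0,q1,q2,q3) ⊂ ℙ¹¹ is irreducible. -/

import Mathlib

/-!
The ideal generated by the four Godeaux quadrics `q0, q1, q2, q3` in the
polynomial ring over `ℂ` in the 12 variables `a^(k)_(i,j)` is prime;
equivalently, the complete intersection `Q = V(q0,q1,q2,q3) ⊂ ℙ¹¹` is
irreducible.

Variable indexing (`Fin 12`):
0 ↦ a^(3)_(2,3), 1 ↦ a^(3)_(1,3), 2 ↦ a^(3)_(0,3), 3 ↦ a^(2)_(2,3),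
4 ↦ a^(2)_(1,2), 5 ↦ a^(2)_(0,2), 6 ↦ a^(1)_(1,3), 7 ↦ a^(1)_(1,2),
8 ↦ a^(1)_(0,1), 9 ↦ a^(0)_(0,3), 10 ↦ a^(0)_(0,2), 11 ↦ a^(0)_(0,1).
-/

open MvPolynomial

noncomputable def godeauxQ0 : MvPolynomial (Fin 12) ℂ := X 7 * X 6 - X 4 * X 3 + X 1 * X 0

noncomputable def godeauxQ1 : MvPolynomial (Fin 12) ℂ := X 10 * X 9 - X 2 * X 0 + X 5 * X 3

noncomputable def godeauxQ2 : MvPolynomial (Fin 12) ℂ := X 8 * X 6 - X 11 * X 9 + X 2 * X 1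

noncomputable def godeauxQ3 : MvPolynomial (Fin 12) ℂ := X 11 * X 10 - X 8 * X 7 + X 5 * X 4

open scoped MonomialOrder

namespace MonomialOrder

variable {σ : Type*} (m : MonomialOrder σ)

/-- The embedding of exponents underlying `MonomialOrder.weighted`. -/
noncomputable def weightedEmbedding (w : σ → ℕ) : (σ →₀ ℕ) →+ ℕ ×ₗ m.syn where
  toFun d := toLex (Finsupp.weight w d, m.toSyn d)
  map_zero' := by simp only [map_zero]; rfl
  map_add' d e := by simp only [map_add]; rfl

lemma weightedEmbedding_injective (w : σ → ℕ) : Function.Injective (m.weightedEmbedding w) := by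
  intro d e h
  exact m.toSyn.injective (congrArg (fun x ↦ (ofLex x).2) h)

/-- `weightedEmbedding` as an equivalence onto its image. -/
noncomputable def weightedEquiv (w : σ → ℕ) :
    (σ →₀ ℕ) ≃+ AddMonoidHom.mrange (m.weightedEmbedding w) where
  toEquiv := Equiv.ofBijective (fun d ↦ ⟨m.weightedEmbedding w d, d, rfl⟩)
    ⟨fun _ _ h ↦ m.weightedEmbedding_injective w (congrArg Subtype.val h),
      fun ⟨_, d, hd⟩ ↦ ⟨d, Subtype.ext hd⟩⟩
  map_add' d e := Subtype.ext (map_add (m.weightedEmbedding w) d e)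

/-- The monomial order comparing weights first and breaking ties with `m`. -/
noncomputable def weighted (w : σ → ℕ) : MonomialOrder σ where
  syn := AddMonoidHom.mrange (m.weightedEmbedding w)
  toSyn := m.weightedEquiv w
  toSyn_monotone d e h := by
    have hw : Finsupp.weight w d ≤ Finsupp.weight w e := by
      obtain ⟨c, rfl⟩ := le_iff_exists_add.1 h
      simp
    exact Prod.Lex.toLex_mono (Prod.mk_le_mk.2 ⟨hw, m.toSyn_monotone h⟩)

lemma weighted_lt_of_weight_lt {w : σ → ℕ} {d e : σ →₀ ℕ}
    (h : Finsupp.weight w d < Finsupp.weight w e) : d ≺[m.weighted w] e :=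
  (Prod.Lex.toLex_lt_toLex (x := (Finsupp.weight w d, m.toSyn d))
    (y := (Finsupp.weight w e, m.toSyn e))).2 (Or.inl h)

variable {m} {K : Type*} [Field K]

/-- The leading monomials of `B` generate the monomial ideal of leading monomials of `span B`. -/
def IsGroebner (m : MonomialOrder σ) (B : Set (MvPolynomial σ K)) : Prop :=
  ∀ f ∈ Ideal.span B, f ≠ 0 → ∃ b ∈ B, m.degree b ≤ m.degree f

lemma isGroebner_empty : m.IsGroebner (∅ : Set (MvPolynomial σ K)) := by
  intro f hf h0
  simp_all

lemma exists_reduced {B : Set (MvPolynomial σ K)} (hB : (0 : MvPolynomial σ K) ∉ B)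
    (f : MvPolynomial σ K) :
    ∃ r, f - r ∈ Ideal.span B ∧ (r ≠ 0 → ∀ b ∈ B, ¬ m.degree b ≤ m.degree r) := by
  obtain ⟨g, r, h, -, hr⟩ := m.div_set (B := B)
    (fun b hb ↦ (m.leadingCoeff_ne_zero_iff.2 (ne_of_mem_of_not_mem hb hB)).isUnit) f
  refine ⟨r, ?_, fun h0 ↦ hr _ (m.degree_mem_support h0)⟩
  rw [h, add_sub_cancel_right]
  exact Ideal.sum_mem _ fun b _ ↦ Ideal.mul_mem_left _ _ (Ideal.subset_span b.2)

/-- `p` has leading monomial coprime to those of `B`. -/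
def CoprimeTo (m : MonomialOrder σ) (p : MvPolynomial σ K) (B : Set (MvPolynomial σ K)) : Prop :=
  ∀ b ∈ B, Disjoint (m.degree b) (m.degree p)

lemma le_of_disjoint_of_le_add {a b c : σ →₀ ℕ} (h : Disjoint a b) (hle : a ≤ b + c) :
    a ≤ c := by
  intro i
  have h1 : a i ≤ b i + c i := hle i
  have h2 : min (a i) (b i) = 0 := DFunLike.congr_fun (disjoint_iff.1 h) i
  omega

lemma IsGroebner.insert {B : Set (MvPolynomial σ K)} (hG : m.IsGroebner B)
    (hB : (0 : MvPolynomial σ K) ∉ B) {q : MvPolynomial σ K} (hq : q ≠ 0)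
    (hc : m.CoprimeTo q B) : m.IsGroebner (insert q B) := by
  intro f hf h0
  obtain ⟨a, z, hz, rfl⟩ := Ideal.mem_span_insert.1 hf
  obtain ⟨r, har, hr⟩ := exists_reduced (m := m) hB a
  obtain ⟨y, hy, hyz⟩ : ∃ y ∈ Ideal.span B, a * q + z = q * r + y :=
    ⟨(a - r) * q + z, add_mem (Ideal.mul_mem_right _ _ har) hz, by ring⟩
  rw [hyz] at h0 ⊢
  by_cases hr0 : r = 0
  · obtain ⟨b, hb, hle⟩ := hG y hy (by simpa [hr0] using h0)
    exact ⟨b, Set.mem_insert_of_mem _ hb, by simpa [hr0] using hle⟩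
  have hdeg : m.degree (q * r) = m.degree q + m.degree r := m.degree_mul hq hr0
  by_cases hy0 : y = 0
  · exact ⟨q, Set.mem_insert _ _, by simp [hy0, hdeg]⟩
  obtain ⟨b, hb, hle⟩ := hG y hy hy0
  rcases lt_trichotomy (m.toSyn (m.degree (q * r))) (m.toSyn (m.degree y)) with h | h | h
  · exact ⟨b, Set.mem_insert_of_mem _ hb, by rwa [m.degree_add_eq_right_of_lt h]⟩
  · rw [m.toSyn.injective h.symm, hdeg] at hle
    exact (hr hr0 b hb (le_of_disjoint_of_le_add (hc b hb) hle)).elim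
  · exact ⟨q, Set.mem_insert _ _, by rw [m.degree_add_of_lt h, hdeg]; simp⟩

lemma IsGroebner.mem_span_of_mul_mem {B : Set (MvPolynomial σ K)} (hG : m.IsGroebner B)
    (hB : (0 : MvPolynomial σ K) ∉ B) {p : MvPolynomial σ K} (hp : p ≠ 0)
    (hc : m.CoprimeTo p B) {f : MvPolynomial σ K} (hf : p * f ∈ Ideal.span B) :
    f ∈ Ideal.span B := by
  obtain ⟨r, har, hr⟩ := exists_reduced (m := m) hB f
  have hpr : p * r ∈ Ideal.span B := by
    have := sub_mem hf (Ideal.mul_mem_left _ p har)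
    rwa [← mul_sub, sub_sub_cancel] at this
  by_cases hr0 : r = 0
  · simpa [hr0] using har
  obtain ⟨b, hb, hle⟩ := hG _ hpr (mul_ne_zero hp hr0)
  rw [m.degree_mul hp hr0] at hle
  exact (hr hr0 b hb (le_of_disjoint_of_le_add (hc b hb) hle)).elim

end MonomialOrder

section Parametrization

variable {σ k S : Type*} [Field k] [CommRing S]

/-- If, away from `s`, the map `φ` parametrizes the zero set of `I` by those variables on which it
agrees with the injection `ι`, then every polynomial killed by `φ` lies in `I` after multiplication
by a power of `s`. -/
lemma exists_pow_mul_mem_of_parametrization {I : Ideal (MvPolynomial σ k)}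
    {φ ι : MvPolynomial σ k →+* S} (hι : Function.Injective ι) (hC : ∀ a, φ (C a) = ι (C a))
    (hI : ∀ f ∈ I, φ f = 0) {s : MvPolynomial σ k} (hs : φ s = ι s)
    (hX : ∀ i, φ (X i) = ι (X i) ∨ ∃ g, φ g = ι g ∧ s * X i - g ∈ I)
    {f : MvPolynomial σ k} (hf : φ f = 0) : ∃ n, s ^ n * f ∈ I := by
  have key : ∀ f : MvPolynomial σ k, ∃ n g, φ g = ι g ∧ s ^ n * f - g ∈ I := by
    intro f
    induction f using MvPolynomial.induction_on with
    | C a => exact ⟨0, C a, hC a, by simp⟩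
    | add p q hp hq =>
      obtain ⟨n, g, hg, hn⟩ := hp
      obtain ⟨l, h, hh, hl⟩ := hq
      refine ⟨n + l, s ^ l * g + s ^ n * h, by simp [hs, hg, hh], ?_⟩
      have := add_mem (I.mul_mem_left (s ^ l) hn) (I.mul_mem_left (s ^ n) hl)
      convert this using 1
      ring
    | mul_X p i hp =>
      obtain ⟨n, g, hg, hn⟩ := hp
      obtain ⟨h, hh, hl⟩ : ∃ g, φ g = ι g ∧ s * X i - g ∈ I := by
        obtain hi | h := hX i
        · exact ⟨s * X i, by simp [hs, hi], by simp⟩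
        · exact h
      refine ⟨n + 1, g * h, by simp [hg, hh], ?_⟩
      have := add_mem (I.mul_mem_left (s * X i) hn) (I.mul_mem_left g hl)
      convert this using 1
      ring
  obtain ⟨n, g, hg, hn⟩ := key f
  have h0 := hI _ hn
  rw [map_sub, map_mul, hf, mul_zero, zero_sub, neg_eq_zero, hg] at h0
  exact ⟨n, by simpa [(map_eq_zero_iff ι hι).1 h0] using hn⟩

end Parametrization

lemma Ideal.add_mul_mem_span_four {R : Type*} [CommRing R] (a b c d w x y z : R) :
    a * w + b * x + c * y + d * z ∈ Ideal.span {w, x, y, z} := by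
  refine add_mem (add_mem (add_mem ?_ ?_) ?_) ?_ <;>
    exact Ideal.mul_mem_left _ _ (Ideal.subset_span (by simp))

lemma Ideal.map_eq_zero_of_mem_span {R S : Type*} [CommRing R] [CommRing S] {φ : R →+* S}
    {B : Set R} (h : ∀ b ∈ B, φ b = 0) : ∀ f ∈ Ideal.span B, φ f = 0 :=
  fun _ hf ↦ (Ideal.span_le (I := RingHom.ker φ)).2 h hf

namespace Godeaux

/-- The weight vanishing exactly on the variables `X 0, X 5, X 6, X 11`. -/
def weight : Fin 12 → ℕ := ![0, 1, 1, 1, 1, 0, 0, 1, 1, 1, 1, 0]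

/-- A monomial order whose leading monomials on the four quadrics are pairwise coprime. -/
noncomputable def order : MonomialOrder (Fin 12) := MonomialOrder.lex.weighted weight

lemma degree_X_mul_X (i j : Fin 12) :
    order.degree (X i * X j : MvPolynomial (Fin 12) ℂ) =
      Finsupp.single i 1 + Finsupp.single j 1 := by
  rw [order.degree_mul (X_ne_zero i) (X_ne_zero j), order.degree_X, order.degree_X]

lemma degree_X_mul_X_lt {i j k l : Fin 12} (h : weight i + weight j < weight k + weight l) :
    order.degree (X i * X j : MvPolynomial (Fin 12) ℂ) ≺[order]
      order.degree (X k * X l : MvPolynomial (Fin 12) ℂ) := by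
  rw [degree_X_mul_X, degree_X_mul_X]
  exact MonomialOrder.weighted_lt_of_weight_lt _ (by simpa [Finsupp.weight_single] using h)

lemma degree_trinomial {i j k l p r : Fin 12} (h : weight k + weight l < weight i + weight j)
    (h' : weight p + weight r < weight i + weight j) :
    order.degree (X i * X j - X k * X l + X p * X r : MvPolynomial (Fin 12) ℂ) =
        Finsupp.single i 1 + Finsupp.single j 1 ∧
      order.degree (X k * X l - X i * X j + X p * X r : MvPolynomial (Fin 12) ℂ) =
        Finsupp.single i 1 + Finsupp.single j 1 := by
  have h1 := degree_X_mul_X_lt h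
  have h2 := degree_X_mul_X_lt h'
  have h3 := order.degree_sub_of_lt h1
  have h4 : order.degree (X k * X l - X i * X j : MvPolynomial (Fin 12) ℂ) =
      order.degree (X i * X j : MvPolynomial (Fin 12) ℂ) := by
    rw [← h3, ← order.degree_neg, neg_sub]
  rw [order.degree_add_of_lt (by rwa [h3]), order.degree_add_of_lt (by rwa [h4]), h3, h4,
    degree_X_mul_X]
  exact ⟨rfl, rfl⟩

lemma degree_Q0 : order.degree godeauxQ0 = Finsupp.single 4 1 + Finsupp.single 3 1 :=
  (degree_trinomial (by decide) (by decide)).2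

lemma degree_Q1 : order.degree godeauxQ1 = Finsupp.single 10 1 + Finsupp.single 9 1 :=
  (degree_trinomial (by decide) (by decide)).1

lemma degree_Q2 : order.degree godeauxQ2 = Finsupp.single 2 1 + Finsupp.single 1 1 := by
  rw [← (degree_trinomial (i := 2) (j := 1) (k := 11) (l := 9) (p := 8) (r := 6) (by decide)
    (by decide)).1, godeauxQ2]
  congr 1
  ring

lemma degree_Q3 : order.degree godeauxQ3 = Finsupp.single 8 1 + Finsupp.single 7 1 :=
  (degree_trinomial (by decide) (by decide)).2

lemma disjoint_single_add_single {i j : Fin 12} {d : Fin 12 →₀ ℕ} (hi : d i = 0) (hj : d j = 0) :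
    Disjoint (Finsupp.single i 1 + Finsupp.single j 1) d := by
  rw [disjoint_iff]
  ext l
  change min ((Finsupp.single i 1 + Finsupp.single j 1 : Fin 12 →₀ ℕ) l) (d l) = 0
  by_cases hil : i = l
  · subst hil; simp [hi]
  by_cases hjl : j = l
  · subst hjl; simp [hj]
  simp [hil, hjl]

lemma ne_zero_of_degree {q : MvPolynomial (Fin 12) ℂ} {i : Fin 12} (h : order.degree q i ≠ 0) :
    q ≠ 0 := by
  rintro rfl
  simp at h

lemma Q0_ne_zero : godeauxQ0 ≠ 0 := ne_zero_of_degree (i := 4) (by simp [degree_Q0])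
lemma Q1_ne_zero : godeauxQ1 ≠ 0 := ne_zero_of_degree (i := 10) (by simp [degree_Q1])
lemma Q2_ne_zero : godeauxQ2 ≠ 0 := ne_zero_of_degree (i := 2) (by simp [degree_Q2])
lemma Q3_ne_zero : godeauxQ3 ≠ 0 := ne_zero_of_degree (i := 8) (by simp [degree_Q3])

lemma isGroebner : order.IsGroebner {godeauxQ0, godeauxQ1, godeauxQ2, godeauxQ3} := by
  rw [← insert_empty_eq godeauxQ3]
  refine (((MonomialOrder.isGroebner_empty.insert ?_ Q3_ne_zero ?_).insert ?_ Q2_ne_zero ?_).insert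
    ?_ Q1_ne_zero ?_).insert ?_ Q0_ne_zero ?_
  all_goals
    simp [MonomialOrder.CoprimeTo, Q1_ne_zero.symm, Q2_ne_zero.symm, Q3_ne_zero.symm,
      degree_Q0, degree_Q1, degree_Q2, degree_Q3, disjoint_single_add_single]

lemma mem_of_X_mul_mem {i : Fin 12} (hi : weight i = 0) {f : MvPolynomial (Fin 12) ℂ}
    (hf : X i * f ∈ Ideal.span {godeauxQ0, godeauxQ1, godeauxQ2, godeauxQ3}) :
    f ∈ Ideal.span {godeauxQ0, godeauxQ1, godeauxQ2, godeauxQ3} := by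
  have hne : ∀ j, weight j ≠ 0 → j ≠ i := by
    rintro j hj rfl
    exact hj hi
  refine isGroebner.mem_span_of_mul_mem ?_ (X_ne_zero i) ?_ hf
  · simp [Q0_ne_zero.symm, Q1_ne_zero.symm, Q2_ne_zero.symm, Q3_ne_zero.symm]
  · simp only [MonomialOrder.CoprimeTo, Set.mem_insert_iff, Set.mem_singleton_iff,
      forall_eq_or_imp, forall_eq, degree_Q0, degree_Q1, degree_Q2, degree_Q3, order.degree_X]
    refine ⟨?_, ?_, ?_, ?_⟩ <;> refine disjoint_single_add_single ?_ ?_ <;>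
      exact Finsupp.single_eq_of_ne (hne _ (by decide))

/-- The field of rational functions in the twelve variables. -/
abbrev RatFun : Type := FractionRing (MvPolynomial (Fin 12) ℂ)

/-- The inclusion of polynomials into rational functions. -/
noncomputable abbrev incl : MvPolynomial (Fin 12) ℂ →+* RatFun := algebraMap _ _

lemma incl_injective : Function.Injective incl := IsFractionRing.injective _ _

/-- The variables as rational functions. -/
noncomputable abbrev x (i : Fin 12) : RatFun := incl (X i)

lemma x_ne_zero (i : Fin 12) : x i ≠ 0 := (map_ne_zero_iff _ incl_injective).2 (X_ne_zero i)

/-- Substitution of rational functions for the variables. -/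
noncomputable abbrev subst (v : Fin 12 → RatFun) : MvPolynomial (Fin 12) ℂ →+* RatFun :=
  (aeval v : MvPolynomial (Fin 12) ℂ →ₐ[ℂ] RatFun).toRingHom

lemma subst_X (v : Fin 12 → RatFun) (i : Fin 12) : subst v (X i) = v i := aeval_X v i

lemma subst_C (v : Fin 12 → RatFun) (a : ℂ) : subst v (C a) = incl (C a) := by
  change aeval v (C a) = _
  rw [aeval_C, IsScalarTower.algebraMap_apply ℂ (MvPolynomial (Fin 12) ℂ) RatFun]
  rfl

lemma incl_ne_zero {p : MvPolynomial (Fin 12) ℂ} (a : Fin 12 → ℂ) (h : eval a p ≠ 0) :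
    incl p ≠ 0 := by
  rw [map_ne_zero_iff _ incl_injective]
  rintro rfl
  simp at h

/-- A minor of the coefficient matrix of `q0, q3` as linear forms in `X 4, X 7`. -/
noncomputable def minor : MvPolynomial (Fin 12) ℂ := X 5 * X 6 - X 8 * X 3

/-- Solution of `q0 = q1 = q3 = 0` for `X 1, X 2, X 4`. -/
noncomputable def solThree : Fin 12 → RatFun :=
  ![x 0, (x 3 * (x 8 * x 7 - x 11 * x 10) - x 7 * x 6 * x 5) / (x 0 * x 5),
    (x 10 * x 9 + x 5 * x 3) / x 0, x 3, (x 8 * x 7 - x 11 * x 10) / x 5, x 5, x 6, x 7, x 8, x 9,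
    x 10, x 11]

lemma subst_solThree_eq_zero :
    ∀ f ∈ Ideal.span {godeauxQ0, godeauxQ1, godeauxQ3}, subst solThree f = 0 := by
  have h0 := x_ne_zero 0
  have h5 := x_ne_zero 5
  refine Ideal.map_eq_zero_of_mem_span ?_
  simp only [Set.mem_insert_iff, Set.mem_singleton_iff, forall_eq_or_imp, forall_eq,
    godeauxQ0, godeauxQ1, godeauxQ3, map_add, map_sub, map_mul, subst_X]
  refine ⟨?_, ?_, ?_⟩ <;> simp [solThree] <;> field_simp <;> ring

lemma exists_pow_mul_mem_three {f : MvPolynomial (Fin 12) ℂ} (hf : subst solThree f = 0) :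
    ∃ n, (X 0 * X 5) ^ n * f ∈ Ideal.span {godeauxQ0, godeauxQ1, godeauxQ3} := by
  have mem (a b c : MvPolynomial (Fin 12) ℂ) : a * godeauxQ0 + b * godeauxQ1 + c * godeauxQ3 ∈
      Ideal.span {godeauxQ0, godeauxQ1, godeauxQ3} := by
    simpa using Ideal.add_mul_mem_span_four a b c 0 godeauxQ0 godeauxQ1 godeauxQ3 godeauxQ3
  refine exists_pow_mul_mem_of_parametrization incl_injective (subst_C _)
    subst_solThree_eq_zero ?_ ?_ hf
  · simp [solThree]
  · intro i
    match i with
    | 1 =>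
      refine Or.inr ⟨X 3 * (X 8 * X 7 - X 11 * X 10) - X 7 * X 6 * X 5, by simp [solThree], ?_⟩
      convert mem (X 5) 0 (X 3) using 1
      simp only [godeauxQ0, godeauxQ1, godeauxQ3]
      ring
    | 2 =>
      refine Or.inr ⟨X 5 * (X 10 * X 9 + X 5 * X 3), by simp [solThree], ?_⟩
      convert mem 0 (-X 5) 0 using 1
      simp only [godeauxQ0, godeauxQ1, godeauxQ3]
      ring
    | 4 =>
      refine Or.inr ⟨X 0 * (X 8 * X 7 - X 11 * X 10), by simp [solThree], ?_⟩
      convert mem 0 0 (X 0) using 1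
      simp only [godeauxQ0, godeauxQ1, godeauxQ3]
      ring
    | 0 | 3 | 5 | 6 | 7 | 8 | 9 | 10 | 11 => exact Or.inl (by simp [solThree])

/-- Solution of `q0 = q1 = q3 = minor = 0` for `X 1, X 2, X 4, X 6`. -/
noncomputable def solMinor : Fin 12 → RatFun :=
  ![x 0, -(x 11 * x 10 * x 3) / (x 0 * x 5), (x 10 * x 9 + x 5 * x 3) / x 0, x 3,
    (x 8 * x 7 - x 11 * x 10) / x 5, x 5, x 8 * x 3 / x 5, x 7, x 8, x 9, x 10, x 11]

lemma subst_solMinor_eq_zero :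
    ∀ f ∈ Ideal.span {godeauxQ0, godeauxQ1, godeauxQ3, minor}, subst solMinor f = 0 := by
  have h0 := x_ne_zero 0
  have h5 := x_ne_zero 5
  refine Ideal.map_eq_zero_of_mem_span ?_
  simp only [Set.mem_insert_iff, Set.mem_singleton_iff, forall_eq_or_imp, forall_eq,
    godeauxQ0, godeauxQ1, godeauxQ3, minor, map_add, map_sub, map_mul, subst_X]
  refine ⟨?_, ?_, ?_, ?_⟩ <;> simp [solMinor] <;> field_simp <;> ring

lemma exists_pow_mul_mem_minor {f : MvPolynomial (Fin 12) ℂ} (hf : subst solMinor f = 0) :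
    ∃ n, (X 0 * X 5) ^ n * f ∈ Ideal.span {godeauxQ0, godeauxQ1, godeauxQ3, minor} := by
  have mem (a b c d : MvPolynomial (Fin 12) ℂ) :=
    Ideal.add_mul_mem_span_four a b c d godeauxQ0 godeauxQ1 godeauxQ3 minor
  refine exists_pow_mul_mem_of_parametrization incl_injective (subst_C _)
    subst_solMinor_eq_zero ?_ ?_ hf
  · simp [solMinor]
  · intro i
    match i with
    | 1 =>
      refine Or.inr ⟨-(X 11 * X 10 * X 3), by simp [solMinor], ?_⟩
      convert mem (X 5) 0 (X 3) (-X 7) using 1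
      simp only [godeauxQ0, godeauxQ1, godeauxQ3, minor]
      ring
    | 2 =>
      refine Or.inr ⟨X 5 * (X 10 * X 9 + X 5 * X 3), by simp [solMinor], ?_⟩
      convert mem 0 (-X 5) 0 0 using 1
      simp only [godeauxQ0, godeauxQ1, godeauxQ3, minor]
      ring
    | 4 =>
      refine Or.inr ⟨X 0 * (X 8 * X 7 - X 11 * X 10), by simp [solMinor], ?_⟩
      convert mem 0 0 (X 0) 0 using 1
      simp only [godeauxQ0, godeauxQ1, godeauxQ3, minor]
      ring
    | 6 =>
      refine Or.inr ⟨X 0 * (X 8 * X 3), by simp [solMinor], ?_⟩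
      convert mem 0 0 0 (X 0) using 1
      simp only [godeauxQ0, godeauxQ1, godeauxQ3, minor]
      ring
    | 0 | 3 | 5 | 7 | 8 | 9 | 10 | 11 => exact Or.inl (by simp [solMinor])

lemma subst_solThree_minor_ne_zero : subst solThree minor ≠ 0 := by
  have h : subst solThree minor = incl minor := by simp [minor, solThree]
  rw [h]
  exact incl_ne_zero (Function.update 1 3 0) (by simp [minor])

lemma subst_solMinor_Q2_ne_zero : subst solMinor godeauxQ2 ≠ 0 := by
  have h0 := x_ne_zero 0
  have h5 := x_ne_zero 5
  have h : subst solMinor godeauxQ2 * (x 0 * x 0 * x 5) =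
      incl (X 0 * X 0 * X 8 * X 8 * X 3 - X 0 * X 0 * X 5 * X 11 * X 9 -
        (X 10 * X 9 + X 5 * X 3) * X 11 * X 10 * X 3) := by
    simp [godeauxQ2, solMinor]
    field_simp
    ring
  intro hzero
  rw [hzero, zero_mul] at h
  exact incl_ne_zero (Function.update 1 11 0) (by simp) h.symm

/-- The ideal of the four quadrics. -/
noncomputable abbrev quadricIdeal : Ideal (MvPolynomial (Fin 12) ℂ) :=
  Ideal.span {godeauxQ0, godeauxQ1, godeauxQ2, godeauxQ3}

lemma mem_of_pow_mul_mem {R : Type*} [CommRing R] {I : Ideal R} {s : R}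
    (hs : ∀ f, s * f ∈ I → f ∈ I) {n : ℕ} {f : R} (hf : s ^ n * f ∈ I) : f ∈ I := by
  induction n with
  | zero => simpa using hf
  | succ n ih => exact ih (hs _ (by rwa [← mul_assoc, ← pow_succ']))

lemma mem_of_minor_mul_mem {f : MvPolynomial (Fin 12) ℂ} (hf : minor * f ∈ quadricIdeal) :
    f ∈ quadricIdeal := by
  have hle : Ideal.span {godeauxQ0, godeauxQ1, godeauxQ3} ≤ quadricIdeal :=
    Ideal.span_mono (by simp [Set.insert_subset_iff])
  have hQ2 : godeauxQ2 ∈ quadricIdeal := Ideal.subset_span (by simp)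
  have cancel : ∀ f, X 0 * X 5 * f ∈ quadricIdeal → f ∈ quadricIdeal := fun f hf ↦
    mem_of_X_mul_mem (i := 5) rfl (mem_of_X_mul_mem (i := 0) rfl (by rwa [← mul_assoc]))
  have hswap : quadricIdeal = Ideal.span {godeauxQ2, godeauxQ0, godeauxQ1, godeauxQ3} := by
    rw [Set.insert_comm godeauxQ2, Set.insert_comm godeauxQ2 godeauxQ1]
  rw [hswap] at hf
  obtain ⟨g, j, hj, hfg⟩ := Ideal.mem_span_insert.1 hf
  have hspan : Ideal.span {godeauxQ0, godeauxQ1, godeauxQ3, minor} =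
      Ideal.span {minor, godeauxQ0, godeauxQ1, godeauxQ3} := by
    rw [Set.insert_comm minor, Set.insert_comm minor godeauxQ1, Set.pair_comm minor]
  have hminor : subst solMinor minor = 0 :=
    subst_solMinor_eq_zero _ (Ideal.subset_span (by simp))
  have hj' : subst solMinor j = 0 :=
    subst_solMinor_eq_zero _ (hspan ▸ Ideal.span_mono (Set.subset_insert _ _) hj)
  have hg : subst solMinor g = 0 := by
    have := congrArg (subst solMinor) hfg
    rw [map_mul, hminor, zero_mul, map_add, map_mul, hj', add_zero] at this
    exact (mul_eq_zero.1 this.symm).resolve_right subst_solMinor_Q2_ne_zero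
  obtain ⟨n, hn⟩ := exists_pow_mul_mem_minor hg
  rw [hspan] at hn
  obtain ⟨h, i, hi, hgi⟩ := Ideal.mem_span_insert.1 hn
  have hmem : minor * ((X 0 * X 5) ^ n * f - h * godeauxQ2) ∈
      Ideal.span {godeauxQ0, godeauxQ1, godeauxQ3} := by
    have := add_mem (Ideal.mul_mem_left _ ((X 0 * X 5) ^ n) hj) (Ideal.mul_mem_right godeauxQ2 _ hi)
    convert this using 1
    linear_combination (X 0 * X 5) ^ n * hfg + godeauxQ2 * hgi
  have hzero := subst_solThree_eq_zero _ hmem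
  rw [map_mul, mul_eq_zero, or_iff_right subst_solThree_minor_ne_zero] at hzero
  obtain ⟨l, hl⟩ := exists_pow_mul_mem_three hzero
  have hsub := mem_of_pow_mul_mem cancel (hle hl)
  exact mem_of_pow_mul_mem cancel
    (by simpa using add_mem hsub (Ideal.mul_mem_left quadricIdeal h hQ2))

/-- A multiple of `minor` modulo `q1, q2`, free of `X 8`. -/
noncomputable def minorNum : MvPolynomial (Fin 12) ℂ :=
  X 0 * X 6 * X 6 * X 5 - X 3 * (X 0 * X 11 * X 9 - X 1 * (X 10 * X 9 + X 5 * X 3))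

lemma mem_of_minorNum_mul_mem {f : MvPolynomial (Fin 12) ℂ} (hf : minorNum * f ∈ quadricIdeal) :
    f ∈ quadricIdeal := by
  refine mem_of_minor_mul_mem (mem_of_X_mul_mem (i := 6) rfl (mem_of_X_mul_mem (i := 0) rfl ?_))
  convert sub_mem hf (Ideal.add_mul_mem_span_four 0 (X 3 * X 1 * f) (X 3 * X 0 * f) 0
    godeauxQ0 godeauxQ1 godeauxQ2 godeauxQ3) using 1
  simp only [minorNum, minor, godeauxQ0, godeauxQ1, godeauxQ2, godeauxQ3]
  ring

/-- Solution of the four quadrics for `X 2, X 4, X 7, X 8`. -/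
noncomputable def solFour : Fin 12 → RatFun :=
  ![x 0, x 1, (x 10 * x 9 + x 5 * x 3) / x 0, x 3,
    -(x 0 * x 6 * x 6 * x 11 * x 10 +
      (x 0 * x 11 * x 9 - x 1 * (x 10 * x 9 + x 5 * x 3)) * x 1 * x 0) / incl minorNum,
    x 5, x 6, -((x 1 * x 0 * x 5 + x 3 * x 11 * x 10) * (x 0 * x 6)) / incl minorNum,
    (x 0 * x 11 * x 9 - x 1 * (x 10 * x 9 + x 5 * x 3)) / (x 0 * x 6), x 9, x 10, x 11]

lemma incl_minorNum_ne_zero : incl minorNum ≠ 0 :=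
  incl_ne_zero (Function.update 1 3 0) (by simp [minorNum])

lemma incl_minorNum : incl minorNum =
    x 0 * x 6 * x 6 * x 5 - x 3 * (x 0 * x 11 * x 9 - x 1 * (x 10 * x 9 + x 5 * x 3)) := by
  simp [minorNum]

lemma subst_solFour_eq_zero : ∀ f ∈ quadricIdeal, subst solFour f = 0 := by
  have h0 := x_ne_zero 0
  have h6 := x_ne_zero 6
  have hm := incl_minorNum_ne_zero
  refine Ideal.map_eq_zero_of_mem_span ?_
  simp only [Set.mem_insert_iff, Set.mem_singleton_iff, forall_eq_or_imp, forall_eq,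
    godeauxQ0, godeauxQ1, godeauxQ2, godeauxQ3, map_add, map_sub, map_mul, subst_X]
  refine ⟨?_, ?_, ?_, ?_⟩ <;> simp [solFour] <;> field_simp <;> (try rw [incl_minorNum]) <;> ring

lemma exists_pow_mul_mem_four {f : MvPolynomial (Fin 12) ℂ} (hf : subst solFour f = 0) :
    ∃ n, (X 0 * X 6 * minorNum) ^ n * f ∈ quadricIdeal := by
  have hs : subst solFour minorNum = incl minorNum := by simp [minorNum, solFour]
  have mem (a b c d : MvPolynomial (Fin 12) ℂ) :=
    Ideal.add_mul_mem_span_four a b c d godeauxQ0 godeauxQ1 godeauxQ2 godeauxQ3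
  refine exists_pow_mul_mem_of_parametrization incl_injective (subst_C _)
    subst_solFour_eq_zero ?_ ?_ hf
  · rw [map_mul, hs]
    simp [solFour]
  · intro i
    match i with
    | 2 =>
      refine Or.inr ⟨X 6 * minorNum * (X 10 * X 9 + X 5 * X 3), ?_, ?_⟩
      · rw [map_mul, map_mul, hs]
        simp [solFour]
      convert mem 0 (-(X 6 * minorNum)) 0 0 using 1
      simp only [godeauxQ0, godeauxQ1, godeauxQ2, godeauxQ3]
      ring
    | 8 =>
      refine Or.inr ⟨minorNum * (X 0 * X 11 * X 9 - X 1 * (X 10 * X 9 + X 5 * X 3)), ?_, ?_⟩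
      · rw [map_mul, hs]
        simp [solFour]
      convert mem 0 (minorNum * X 1) (minorNum * X 0) 0 using 1
      simp only [godeauxQ0, godeauxQ1, godeauxQ2, godeauxQ3]
      ring
    | 7 =>
      refine Or.inr ⟨-((X 1 * X 0 * X 5 + X 3 * X 11 * X 10) * (X 0 * X 6) * (X 0 * X 6)),
        by simp [solFour], ?_⟩
      convert mem (X 0 * X 6 * (X 0 * X 6 * X 5)) (X 0 * X 6 * (X 7 * X 3 * X 1))
        (X 0 * X 6 * (X 7 * X 3 * X 0)) (X 0 * X 6 * (X 0 * X 6 * X 3)) using 1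
      simp only [minorNum, godeauxQ0, godeauxQ1, godeauxQ2, godeauxQ3]
      ring
    | 4 =>
      refine Or.inr ⟨-(X 0 * X 6 * (X 0 * X 6 * X 6 * X 11 * X 10 +
        (X 0 * X 11 * X 9 - X 1 * (X 10 * X 9 + X 5 * X 3)) * X 1 * X 0)),
        by simp [solFour], ?_⟩
      convert mem (X 0 * X 6 * (X 0 * X 6 * X 8)) (X 0 * X 6 * ((X 4 * X 3 - X 1 * X 0) * X 1))
        (X 0 * X 6 * ((X 4 * X 3 - X 1 * X 0) * X 0)) (X 0 * X 6 * (X 0 * X 6 * X 6)) using 1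
      simp only [minorNum, godeauxQ0, godeauxQ1, godeauxQ2, godeauxQ3]
      ring
    | 0 | 1 | 3 | 5 | 6 | 9 | 10 | 11 => exact Or.inl (by simp [solFour])

lemma quadricIdeal_eq_ker : quadricIdeal = RingHom.ker (subst solFour) := by
  refine le_antisymm subst_solFour_eq_zero fun f hf ↦ ?_
  obtain ⟨n, hn⟩ := exists_pow_mul_mem_four hf
  refine mem_of_pow_mul_mem (fun g hg ↦ ?_) hn
  rw [mul_assoc, mul_assoc] at hg
  exact mem_of_minorNum_mul_mem
    (mem_of_X_mul_mem (i := 6) rfl (mem_of_X_mul_mem (i := 0) rfl hg))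

end Godeaux

/-- The ideal `(q0, q1, q2, q3) ⊂ ℂ[a^(k)_(i,j)]` is prime. -/
theorem godeaux_quadrics_span_isPrime :
    (Ideal.span {godeauxQ0, godeauxQ1, godeauxQ2, godeauxQ3}).IsPrime := by
  change Godeaux.quadricIdeal.IsPrime
  rw [Godeaux.quadricIdeal_eq_ker]
  exact RingHom.ker_isPrime _
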